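/- For a non-degenerate quadratic form q over ℚ, the Hasse invariant ε_ν(q) equals +1 for all but finitely many places ν, and the product of ε_ν(q) over all places ν of ℚ (including the real place) equals +1. -/

import Mathlib

noncomputable section

open Classical in
/-- The Hilbert symbol over a field `K`: it is `1` if the conic
`z² = a x² + b y²` has a nontrivial solution over `K`, and `-1` otherwise. -/
def hilbertSym (K : Type*) [Field K] (a b : K) : ℤ :=
  if ∃ x y z : K, (x, y, z) ≠ (0, 0, 0) ∧ z ^ 2 = a * x ^ 2 + b * y ^ 2 then 1 else -1

/-- The Hasse–Witt invariant `ε(q) = ∏_{i<j} (a_i, a_j)` of the diagonal quadratic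
form `⟨a 0, …, a (n-1)⟩` over `K`. -/
def hasseInv (K : Type*) [Field K] {n : ℕ} (a : Fin n → K) : ℤ :=
  ∏ i : Fin n, ∏ j : Fin n, if i < j then hilbertSym K (a i) (a j) else 1

instance (q : Nat.Primes) : Fact (Nat.Prime (q : ℕ)) := ⟨q.2⟩

/-- Hasse invariant of the rational diagonal form `⟨a i⟩` at the real place. -/
def epsReal {n : ℕ} (a : Fin n → ℚ) : ℤ :=
  hasseInv ℝ fun i => (a i : ℝ)

/-- Hasse invariant of the rational diagonal form `⟨a i⟩` at a finite place `q`. -/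
def epsP {n : ℕ} (a : Fin n → ℚ) (q : Nat.Primes) : ℤ :=
  hasseInv ℚ_[(q : ℕ)] fun i => (a i : ℚ_[(q : ℕ)])

section Field

variable {K : Type*} [Field K]

theorem hilbertSym_eq_one_iff {a b : K} : hilbertSym K a b = 1 ↔
    ∃ x y z : K, (x, y, z) ≠ (0, 0, 0) ∧ z ^ 2 = a * x ^ 2 + b * y ^ 2 := by
  unfold hilbertSym
  split_ifs with h
  · exact iff_of_true rfl h
  · exact iff_of_false (by decide) h

theorem hilbertSym_eq_one_or_neg_one (a b : K) :
    hilbertSym K a b = 1 ∨ hilbertSym K a b = -1 := by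
  unfold hilbertSym
  split_ifs <;> simp

theorem hilbertSym_eq_neg_one_iff {a b : K} :
    hilbertSym K a b = -1 ↔ hilbertSym K a b ≠ 1 := by
  rcases hilbertSym_eq_one_or_neg_one a b with h | h <;> rw [h] <;> decide

theorem hilbertSym_congr {L : Type*} [Field L] {a b : K} {c d : L}
    (h : hilbertSym K a b = 1 ↔ hilbertSym L c d = 1) : hilbertSym K a b = hilbertSym L c d := by
  rcases hilbertSym_eq_one_or_neg_one a b with h₁ | h₁ <;>
    rcases hilbertSym_eq_one_or_neg_one c d with h₂ | h₂ <;> simp_all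

theorem hilbertSym_comm (a b : K) : hilbertSym K a b = hilbertSym K b a := by
  refine hilbertSym_congr ?_
  simp only [hilbertSym_eq_one_iff]
  constructor <;>
  · rintro ⟨x, y, z, h0, h⟩
    refine ⟨y, x, z, ?_, by rw [h, add_comm]⟩
    contrapose! h0
    simp_all

theorem hilbertSym_eq_one_of_sq_eq {a b x y z : K} (hz : z ≠ 0)
    (h : z ^ 2 = a * x ^ 2 + b * y ^ 2) : hilbertSym K a b = 1 :=
  hilbertSym_eq_one_iff.2 ⟨x, y, z, by simp [hz], h⟩

variable [NeZero (2 : K)]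

/-- The Hilbert symbol `(a, b)` is trivial exactly when `b` is a value of the norm form of
`K(√a)`. -/
theorem hilbertSym_eq_one_iff_exists_norm {a : K} (ha : a ≠ 0) (b : K) :
    hilbertSym K a b = 1 ↔ ∃ s t : K, b = s ^ 2 - a * t ^ 2 := by
  rw [hilbertSym_eq_one_iff]
  constructor
  · rintro ⟨x, y, z, h0, h⟩
    by_cases hy : y = 0
    · subst hy
      have hx : x ≠ 0 := by
        rintro rfl
        simp_all
      have hz : z ≠ 0 := by
        rintro rfl
        simp_all
      have h2 : (2 : K) ≠ 0 := NeZero.ne 2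
      refine ⟨(b + 1) / 2, (b - 1) * x / (2 * z), ?_⟩
      field_simp
      linear_combination -(b - 1) ^ 2 * h
    · exact ⟨z / y, x / y, by field_simp; linear_combination -h⟩
  · rintro ⟨s, t, rfl⟩
    exact ⟨t, 1, s, by simp, by ring⟩

theorem hilbertSym_sq_mul_right {a : K} (ha : a ≠ 0) (b : K) {c : K} (hc : c ≠ 0) :
    hilbertSym K a (c ^ 2 * b) = hilbertSym K a b := by
  refine hilbertSym_congr ?_
  simp only [hilbertSym_eq_one_iff_exists_norm ha]
  constructor
  · rintro ⟨s, t, h⟩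
    exact ⟨s / c, t / c, by field_simp; linear_combination h⟩
  · rintro ⟨s, t, rfl⟩
    exact ⟨c * s, c * t, by ring⟩

theorem hilbertSym_sq_right {a : K} (ha : a ≠ 0) (c : K) : hilbertSym K a (c ^ 2) = 1 :=
  (hilbertSym_eq_one_iff_exists_norm ha _).2 ⟨c, 0, by ring⟩

theorem hilbertSym_mul_right_of_eq_one {a b : K} (ha : a ≠ 0) (hb : b ≠ 0) (c : K)
    (h : hilbertSym K a b = 1) : hilbertSym K a (b * c) = hilbertSym K a c := by
  have key : ∀ d, hilbertSym K a d = 1 → hilbertSym K a (b * d) = 1 := by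
    intro d hd
    obtain ⟨s, t, h⟩ := (hilbertSym_eq_one_iff_exists_norm ha _).1 h
    obtain ⟨s', t', hd⟩ := (hilbertSym_eq_one_iff_exists_norm ha _).1 hd
    exact (hilbertSym_eq_one_iff_exists_norm ha _).2
      ⟨s * s' + a * t * t', s * t' + t * s', by rw [h, hd]; ring⟩
  refine hilbertSym_congr ⟨fun h' => ?_, key c⟩
  have := key _ h'
  rwa [← mul_assoc, ← sq, hilbertSym_sq_mul_right ha _ hb] at this

theorem hilbertSym_neg_mul_right {a : K} (ha : a ≠ 0) (b : K) :
    hilbertSym K a (-a * b) = hilbertSym K a b :=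
  hilbertSym_mul_right_of_eq_one ha (neg_ne_zero.2 ha) b
    ((hilbertSym_eq_one_iff_exists_norm ha _).2 ⟨0, 1, by ring⟩)

end Field

theorem hilbertSym_real {a b : ℝ} (ha : a ≠ 0) (hb : b ≠ 0) :
    hilbertSym ℝ a b = if 0 < a ∨ 0 < b then 1 else -1 := by
  split_ifs with h
  · rcases h with h | h
    · exact hilbertSym_eq_one_of_sq_eq (x := 1) (y := 0) (z := √a)
        (Real.sqrt_pos.2 h).ne' (by simp [Real.sq_sqrt h.le])
    · exact hilbertSym_eq_one_of_sq_eq (x := 0) (y := 1) (z := √b)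
        (Real.sqrt_pos.2 h).ne' (by simp [Real.sq_sqrt h.le])
  · push Not at h
    rw [hilbertSym_eq_neg_one_iff, Ne, hilbertSym_eq_one_iff]
    rintro ⟨x, y, z, h0, hz⟩
    have ha' : a < 0 := lt_of_le_of_ne h.1 ha
    have hb' : b < 0 := lt_of_le_of_ne h.2 hb
    have hx : x = 0 := by
      by_contra hx
      nlinarith [mul_neg_of_neg_of_pos ha' (pow_pos (abs_pos.2 hx) 2), sq_abs x,
        mul_nonneg (neg_nonneg.2 hb'.le) (sq_nonneg y), sq_nonneg z]
    have hy : y = 0 := by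
      by_contra hy
      nlinarith [mul_neg_of_neg_of_pos hb' (pow_pos (abs_pos.2 hy) 2), sq_abs y,
        mul_nonneg (neg_nonneg.2 ha'.le) (sq_nonneg x), sq_nonneg z]
    simp_all

theorem hilbertSym_real_mul_right {a b c : ℝ} (ha : a ≠ 0) (hb : b ≠ 0) (hc : c ≠ 0) :
    hilbertSym ℝ a (b * c) = hilbertSym ℝ a b * hilbertSym ℝ a c := by
  rw [hilbertSym_real ha hb, hilbertSym_real ha hc, hilbertSym_real ha (mul_ne_zero hb hc)]
  rcases ha.lt_or_gt with ha | ha <;> rcases hb.lt_or_gt with hb | hb <;>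
    rcases hc.lt_or_gt with hc | hc <;>
    simp [ha, hb, hc, ha.not_gt, hb.not_gt, hc.not_gt, mul_pos_iff]


section Padic

open PadicInt

variable {p : ℕ} [Fact p.Prime]

theorem Padic.exists_sq_mul_unit {x : ℚ_[p]} (hx : x ≠ 0) :
    ∃ c : ℚ_[p], c ≠ 0 ∧ ∃ u : ℤ_[p]ˣ, x = c ^ 2 * (u : ℤ_[p]) ∨ x = c ^ 2 * (p * (u : ℤ_[p])) := by
  have hp : (p : ℚ_[p]) ≠ 0 := by exact_mod_cast (Fact.out : p.Prime).ne_zero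
  have hp' : (p : ℝ) ≠ 0 := by exact_mod_cast (Fact.out : p.Prime).ne_zero
  have hu : ‖x * (p : ℚ_[p]) ^ (-x.valuation)‖ = 1 := by
    rw [norm_mul, Padic.norm_eq_zpow_neg_valuation hx, norm_zpow, Padic.norm_p, inv_zpow,
      ← zpow_neg, ← zpow_add₀ hp']
    simp
  have hxu : x = (p : ℚ_[p]) ^ x.valuation * (mkUnits hu : ℤ_[p]) := by
    rw [mkUnits_eq, mul_left_comm, ← zpow_add₀ hp]
    simp
  rcases Int.even_or_odd' x.valuation with ⟨k, hk | hk⟩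
  · refine ⟨(p : ℚ_[p]) ^ k, zpow_ne_zero _ hp, mkUnits hu, Or.inl ?_⟩
    rw [← zpow_natCast, ← zpow_mul, mul_comm k, Nat.cast_ofNat, ← hk]
    exact hxu
  · refine ⟨(p : ℚ_[p]) ^ k, zpow_ne_zero _ hp, mkUnits hu, Or.inr ?_⟩
    rw [← zpow_natCast, ← zpow_mul, mul_comm k, Nat.cast_ofNat, ← mul_assoc, ← zpow_add_one₀ hp,
      ← hk]
    exact hxu

theorem PadicInt.isSquare_of_norm_lt {u a : ℤ_[p]} (h : ‖a ^ 2 - u‖ < ‖2 * a‖ ^ 2) :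
    IsSquare u := by
  open Polynomial in
  obtain ⟨z, hz, -⟩ := hensels_lemma (F := (X ^ 2 - C u : ℤ_[p][X])) (a := a)
    (by simpa [one_add_one_eq_two] using h)
  exact ⟨z, by linear_combination -(by simpa using hz : z ^ 2 - u = 0)⟩

/-- A nontrivial solution of `z² = a x² + b y²` with integral coefficients can be made
primitive. -/
theorem exists_primitive_of_hilbertSym_eq_one {a b : ℤ_[p]}
    (h : hilbertSym ℚ_[p] a b = 1) : ∃ x y z : ℤ_[p],
      (IsUnit x ∨ IsUnit y ∨ IsUnit z) ∧ z ^ 2 = a * x ^ 2 + b * y ^ 2 := by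
  obtain ⟨x, y, z, h0, h⟩ := hilbertSym_eq_one_iff.1 h
  have key : ∀ w : ℚ_[p], (w = x ∨ w = y ∨ w = z) → ‖x‖ ≤ ‖w‖ → ‖y‖ ≤ ‖w‖ → ‖z‖ ≤ ‖w‖ →
      ∃ x y z : ℤ_[p], (IsUnit x ∨ IsUnit y ∨ IsUnit z) ∧ z ^ 2 = a * x ^ 2 + b * y ^ 2 := by
    intro w hw hx hy hz
    have hw0 : w ≠ 0 := by
      rintro rfl
      simp only [norm_zero, norm_le_zero_iff] at hx hy hz
      simp [hx, hy, hz] at h0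
    have hdiv : ∀ t : ℚ_[p], ‖t‖ ≤ ‖w‖ → ∃ t' : ℤ_[p], (t' : ℚ_[p]) = t / w := fun t ht =>
      ⟨⟨t / w, by rw [norm_div]; exact div_le_one_of_le₀ ht (norm_nonneg _)⟩, rfl⟩
    obtain ⟨x', hx'⟩ := hdiv x hx
    obtain ⟨y', hy'⟩ := hdiv y hy
    obtain ⟨z', hz'⟩ := hdiv z hz
    refine ⟨x', y', z', ?_, ?_⟩
    · simp only [PadicInt.isUnit_iff, PadicInt.norm_def, hx', hy', hz']
      rcases hw with rfl | rfl | rfl <;> simp [hw0]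
    · apply PadicInt.ext
      simp only [PadicInt.coe_add, PadicInt.coe_mul, PadicInt.coe_pow, hx', hy', hz']
      field_simp
      linear_combination h
  rcases le_total ‖x‖ ‖y‖ with h1 | h1 <;> rcases le_total ‖y‖ ‖z‖ with h2 | h2 <;>
    rcases le_total ‖x‖ ‖z‖ with h3 | h3
  all_goals first
    | exact key x (by simp) (by linarith) (by linarith) (by linarith)
    | exact key y (by simp) (by linarith) (by linarith) (by linarith)
    | exact key z (by simp) (by linarith) (by linarith) (by linarith)

theorem hilbertSym_eq_one_of_isSquare_add {a b x y : ℤ_[p]} (hu : IsUnit (a * x ^ 2 + b * y ^ 2))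
    (h : IsSquare (a * x ^ 2 + b * y ^ 2)) : hilbertSym ℚ_[p] a b = 1 := by
  obtain ⟨z, hz⟩ := h
  refine hilbertSym_eq_one_of_sq_eq (x := x) (y := y) (z := z) ?_ ?_
  · rw [hz] at hu
    exact PadicInt.coe_ne_zero.2 (isUnit_of_mul_isUnit_left hu).ne_zero
  · have := congrArg (Subtype.val : ℤ_[p] → ℚ_[p]) hz
    simp only [PadicInt.coe_add, PadicInt.coe_mul, PadicInt.coe_pow] at this
    rw [this, sq]

theorem PadicInt.toZMod_eq_zero_iff {x : ℤ_[p]} : toZMod x = 0 ↔ ¬ IsUnit x := by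
  rw [← RingHom.mem_ker, ker_toZMod, IsLocalRing.mem_maximalIdeal, mem_nonunits_iff]

theorem PadicInt.isSquare_of_isSquare_toZMod (hp : p ≠ 2) {u : ℤ_[p]} (hu : IsUnit u)
    (h : IsSquare (toZMod u)) : IsSquare u := by
  obtain ⟨r, hr⟩ := h
  obtain ⟨a, rfl⟩ := ZMod.ringHom_surjective (toZMod (p := p)) r
  have ha : IsUnit a := by
    by_contra ha
    rw [← toZMod_eq_zero_iff] at ha
    rw [ha, mul_zero, toZMod_eq_zero_iff] at hr
    exact hr hu
  have h2 : IsUnit (2 : ℤ_[p]) := by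
    by_contra h2
    rw [← toZMod_eq_zero_iff, map_ofNat] at h2
    have : (p : ℕ) ∣ 2 := (ZMod.natCast_eq_zero_iff 2 p).1 (by exact_mod_cast h2)
    exact hp ((Nat.prime_dvd_prime_iff_eq Fact.out Nat.prime_two).1 this)
  apply isSquare_of_norm_lt (a := a)
  rw [PadicInt.isUnit_iff.1 (h2.mul ha), one_pow, ← PadicInt.not_isUnit_iff, ← toZMod_eq_zero_iff]
  rw [map_sub, map_pow, hr, sq, sub_self]

theorem hilbertSym_units (hp : p ≠ 2) (u v : ℤ_[p]ˣ) :
    hilbertSym ℚ_[p] (u : ℤ_[p]) (v : ℤ_[p]) = 1 := by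
  have hu : toZMod (u : ℤ_[p]) ≠ 0 := by simp [toZMod_eq_zero_iff]
  have hv : toZMod (v : ℤ_[p]) ≠ 0 := by simp [toZMod_eq_zero_iff]
  set u' := toZMod (u : ℤ_[p])
  set v' := toZMod (v : ℤ_[p])
  obtain ⟨r, s, hrs⟩ : ∃ r s : ZMod p, u' * r ^ 2 + v' * s ^ 2 = 1 := by
    open Polynomial in
    obtain ⟨r, s, h⟩ := FiniteField.exists_root_sum_quadratic
      (f := C u' * X ^ 2) (g := C v' * X ^ 2 - C 1) (degree_C_mul_X_pow 2 hu)
      (by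
        have : degree (C 1 : (ZMod p)[X]) < degree (C v' * X ^ 2) := by
          rw [degree_C_mul_X_pow 2 hv]
          exact degree_C_le.trans_lt (by norm_num)
        rw [degree_sub_eq_left_of_degree_lt this, degree_C_mul_X_pow 2 hv, Nat.cast_ofNat])
      (by rw [ZMod.card]; exact (Fact.out : p.Prime).eq_two_or_odd.resolve_left hp)
    exact ⟨r, s, by simpa [add_sub_assoc', sub_eq_zero] using h⟩
  obtain ⟨x, rfl⟩ := ZMod.ringHom_surjective (toZMod (p := p)) r
  obtain ⟨y, rfl⟩ := ZMod.ringHom_surjective (toZMod (p := p)) s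
  have h1 : toZMod ((u : ℤ_[p]) * x ^ 2 + (v : ℤ_[p]) * y ^ 2) = 1 := by simpa [u', v'] using hrs
  have hunit : IsUnit ((u : ℤ_[p]) * x ^ 2 + (v : ℤ_[p]) * y ^ 2) := by
    by_contra hn
    rw [← toZMod_eq_zero_iff, h1] at hn
    exact one_ne_zero hn
  exact hilbertSym_eq_one_of_isSquare_add hunit
    (isSquare_of_isSquare_toZMod hp hunit (by rw [h1]; exact .one))

theorem hilbertSym_unit_p_mul_unit (hp : p ≠ 2) (u v : ℤ_[p]ˣ) :
    hilbertSym ℚ_[p] (u : ℤ_[p]) (p * (v : ℤ_[p])) =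
      quadraticChar (ZMod p) (toZMod (u : ℤ_[p])) := by
  have hu : toZMod (u : ℤ_[p]) ≠ 0 := by simp [toZMod_eq_zero_iff]
  have hcast : ((p : ℚ_[p]) * (v : ℤ_[p])) = ((p * v : ℤ_[p]) : ℚ_[p]) := by simp
  rw [hcast]
  by_cases hsq : IsSquare (toZMod (u : ℤ_[p]))
  · rw [(quadraticChar_one_iff_isSquare hu).2 hsq]
    exact hilbertSym_eq_one_of_isSquare_add (x := 1) (y := 0) (by simp)
      (by simpa using isSquare_of_isSquare_toZMod hp u.isUnit hsq)
  · rw [quadraticChar_neg_one_iff_not_isSquare.2 hsq, hilbertSym_eq_neg_one_iff]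
    intro h
    obtain ⟨x, y, z, hprim, h⟩ := exists_primitive_of_hilbertSym_eq_one h
    have hmod := congrArg toZMod h
    simp only [map_add, map_mul, map_pow, map_natCast, CharP.cast_eq_zero, zero_mul,
      add_zero] at hmod
    have hx : toZMod x = 0 := by
      by_contra hx
      refine hsq ⟨toZMod z / toZMod x, ?_⟩
      field_simp
      exact hmod.symm
    have hz : toZMod z = 0 := by simpa [hx] using hmod
    have hy : IsUnit y := by
      rw [toZMod_eq_zero_iff] at hx hz
      tauto
    have hdvd : ∀ {t : ℤ_[p]}, toZMod t = 0 → (p : ℤ_[p]) ∣ t := fun ht => by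
      rwa [← RingHom.mem_ker, ker_toZMod, maximalIdeal_eq_span_p, Ideal.mem_span_singleton] at ht
    obtain ⟨x', rfl⟩ := hdvd hx
    obtain ⟨z', rfl⟩ := hdvd hz
    have hp0 : (p : ℤ_[p]) ≠ 0 := by exact_mod_cast (Fact.out : p.Prime).ne_zero
    have h' : (v : ℤ_[p]) * y ^ 2 = p * (z' ^ 2 - u * x' ^ 2) :=
      mul_left_cancel₀ hp0 (by linear_combination -h)
    have : IsUnit (v * y ^ 2 : ℤ_[p]) := v.isUnit.mul (hy.pow 2)
    rw [h'] at this
    exact PadicInt.prime_p.not_isUnit (isUnit_of_mul_isUnit_left this)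

/-- Bimultiplicativity of the Hilbert symbol over `ℚ_[p]` reduces to the case where one of the
arguments is a unit. -/
theorem hilbertSym_mul_right_of_units
    (h₀₀ : ∀ u v w : ℤ_[p]ˣ, hilbertSym ℚ_[p] (u : ℤ_[p]) ((v : ℤ_[p]) * (w : ℤ_[p])) =
      hilbertSym ℚ_[p] (u : ℤ_[p]) (v : ℤ_[p]) * hilbertSym ℚ_[p] (u : ℤ_[p]) (w : ℤ_[p]))
    (h₀₁ : ∀ u v w : ℤ_[p]ˣ, hilbertSym ℚ_[p] (u : ℤ_[p]) (p * ((v : ℤ_[p]) * (w : ℤ_[p]))) =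
      hilbertSym ℚ_[p] (u : ℤ_[p]) (p * (v : ℤ_[p])) * hilbertSym ℚ_[p] (u : ℤ_[p]) (w : ℤ_[p]))
    (h₁₁ : ∀ u v w : ℤ_[p]ˣ, hilbertSym ℚ_[p] (u : ℤ_[p]) ((v : ℤ_[p]) * (w : ℤ_[p])) =
      hilbertSym ℚ_[p] (u : ℤ_[p]) (p * (v : ℤ_[p])) *
        hilbertSym ℚ_[p] (u : ℤ_[p]) (p * (w : ℤ_[p])))
    (h₁₀ : ∀ u v w : ℤ_[p]ˣ, hilbertSym ℚ_[p] (p * (u : ℤ_[p])) ((v : ℤ_[p]) * (w : ℤ_[p])) =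
      hilbertSym ℚ_[p] (p * (u : ℤ_[p])) (v : ℤ_[p]) *
        hilbertSym ℚ_[p] (p * (u : ℤ_[p])) (w : ℤ_[p]))
    {a b c : ℚ_[p]} (ha : a ≠ 0) (hb : b ≠ 0) (hc : c ≠ 0) :
    hilbertSym ℚ_[p] a (b * c) = hilbertSym ℚ_[p] a b * hilbertSym ℚ_[p] a c := by
  have hp : (p : ℚ_[p]) ≠ 0 := by exact_mod_cast (Fact.out : p.Prime).ne_zero
  have hunit : ∀ u : ℤ_[p]ˣ, ((u : ℤ_[p]) : ℚ_[p]) ≠ 0 := fun u =>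
    PadicInt.coe_ne_zero.2 u.ne_zero
  have hpu : ∀ u : ℤ_[p]ˣ, (p : ℚ_[p]) * (u : ℤ_[p]) ≠ 0 := fun u => mul_ne_zero hp (hunit u)
  have hflip : ∀ (u : ℤ_[p]ˣ) (x : ℚ_[p]), hilbertSym ℚ_[p] (p * (u : ℤ_[p])) (p * x) =
      hilbertSym ℚ_[p] (p * (u : ℤ_[p])) (((-u : ℤ_[p]ˣ) : ℤ_[p]) * x) := by
    intro u x
    rw [← hilbertSym_neg_mul_right (hpu u), ← hilbertSym_sq_mul_right (hpu u) (_ * x) hp]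
    congr 1
    simp only [Units.val_neg, PadicInt.coe_neg]
    ring
  obtain ⟨r, hr, u, hu⟩ := Padic.exists_sq_mul_unit ha
  obtain ⟨s, hs, v, hv⟩ := Padic.exists_sq_mul_unit hb
  obtain ⟨t, ht, w, hw⟩ := Padic.exists_sq_mul_unit hc
  have hred : ∀ a' b' c' : ℚ_[p], a = r ^ 2 * a' → b = s ^ 2 * b' → c = t ^ 2 * c' →
      hilbertSym ℚ_[p] a' (b' * c') = hilbertSym ℚ_[p] a' b' * hilbertSym ℚ_[p] a' c' →
      hilbertSym ℚ_[p] a (b * c) = hilbertSym ℚ_[p] a b * hilbertSym ℚ_[p] a c := by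
    rintro a' b' c' rfl rfl rfl h
    have hleft : ∀ x, x ≠ 0 → hilbertSym ℚ_[p] (r ^ 2 * a') x = hilbertSym ℚ_[p] a' x := by
      intro x hx
      rw [hilbertSym_comm, hilbertSym_sq_mul_right hx _ hr, hilbertSym_comm]
    have ha' : a' ≠ 0 := right_ne_zero_of_mul ha
    rw [hleft _ (mul_ne_zero hb hc), hleft _ hb, hleft _ hc, hilbertSym_sq_mul_right ha' _ hs,
      hilbertSym_sq_mul_right ha' _ ht, ← h,
      ← hilbertSym_sq_mul_right ha' (b' * c') (mul_ne_zero hs ht)]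
    congr 1
    ring
  rcases hu with hu | hu <;> rcases hv with hv | hv <;> rcases hw with hw | hw <;>
    refine hred _ _ _ hu hv hw ?_
  · exact h₀₀ u v w
  · rw [mul_left_comm, mul_comm (v : ℤ_[p]).1, h₀₁, mul_comm]
  · rw [mul_assoc, h₀₁]
  · rw [← h₁₁, mul_mul_mul_comm, ← sq, hilbertSym_sq_mul_right (hunit u) _ hp]
  · exact h₁₀ u v w
  · rw [mul_left_comm, hflip, hflip, mul_left_comm]
    have := h₁₀ u v (-u * w)
    simpa only [Units.val_mul, PadicInt.coe_mul] using this
  · rw [mul_assoc, hflip, hflip, ← mul_assoc]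
    have := h₁₀ u (-u * v) w
    simpa only [Units.val_mul, PadicInt.coe_mul] using this
  · have := h₁₀ u (-u * v) (-u * w)
    simp only [Units.val_mul, PadicInt.coe_mul] at this
    rw [hflip, hflip, ← this, mul_mul_mul_comm, ← sq, mul_mul_mul_comm _ (v : ℤ_[p]).1, ← sq,
      hilbertSym_sq_mul_right (hpu u) _ hp, hilbertSym_sq_mul_right (hpu u) _ (hunit (-u))]

theorem hilbertSym_padic_mul_right_of_ne_two (hp : p ≠ 2) {a b c : ℚ_[p]} (ha : a ≠ 0)
    (hb : b ≠ 0) (hc : c ≠ 0) :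
    hilbertSym ℚ_[p] a (b * c) = hilbertSym ℚ_[p] a b * hilbertSym ℚ_[p] a c := by
  have hunits : ∀ u v w : ℤ_[p]ˣ,
      hilbertSym ℚ_[p] (u : ℤ_[p]) ((v : ℤ_[p]) * (w : ℤ_[p])) = 1 := fun u v w => by
    simpa using hilbertSym_units hp u (v * w)
  have hpunits : ∀ u v w : ℤ_[p]ˣ, hilbertSym ℚ_[p] (u : ℤ_[p]) (p * ((v : ℤ_[p]) * (w : ℤ_[p]))) =
      quadraticChar (ZMod p) (toZMod (u : ℤ_[p])) := fun u v w => by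
    simpa using hilbertSym_unit_p_mul_unit hp u (v * w)
  refine hilbertSym_mul_right_of_units ?_ ?_ ?_ ?_ ha hb hc <;> intro u v w
  · rw [hunits, hilbertSym_units hp, hilbertSym_units hp, one_mul]
  · rw [hpunits, hilbertSym_unit_p_mul_unit hp, hilbertSym_units hp, mul_one]
  · rw [hunits, hilbertSym_unit_p_mul_unit hp, hilbertSym_unit_p_mul_unit hp, ← sq]
    exact (quadraticChar_sq_one (by simp [toZMod_eq_zero_iff])).symm
  · rw [hilbertSym_comm, hilbertSym_comm _ (v : ℤ_[p]).1, hilbertSym_comm _ (w : ℤ_[p]).1,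
      hilbertSym_unit_p_mul_unit hp, hilbertSym_unit_p_mul_unit hp, ← map_mul, ← map_mul]
    simpa using hilbertSym_unit_p_mul_unit hp (v * w) u

section TwoAdic

/-- Reduction of `2`-adic integers modulo `8`. -/
def toZModEight : ℤ_[2] →+* ZMod 8 := toZModPow 3

theorem toZModEight_eq_zero_iff {x : ℤ_[2]} : toZModEight x = 0 ↔ 8 ∣ x := by
  have h : toZModEight x = 0 ↔ x ∈ RingHom.ker (toZModPow (p := 2) 3) := Iff.rfl
  rw [h, ker_toZModPow, Ideal.mem_span_singleton]
  norm_num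

theorem isUnit_iff_toZModEight {x : ℤ_[2]} : IsUnit x ↔ 4 * toZModEight x = 4 := by
  constructor
  · rintro h
    obtain ⟨y, hy⟩ := h.exists_right_inv
    have := congrArg toZModEight hy
    rw [map_mul, map_one] at this
    generalize toZModEight x = a at *
    generalize toZModEight y = b at *
    revert a b
    decide
  · intro h
    by_contra hx
    rw [← mem_nonunits_iff, ← IsLocalRing.mem_maximalIdeal, maximalIdeal_eq_span_p,
      Ideal.mem_span_singleton] at hx
    obtain ⟨y, rfl⟩ := hx
    rw [map_mul, map_natCast] at h
    generalize toZModEight y = b at *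
    revert b
    decide

theorem isSquare_of_toZModEight_eq_one {u : ℤ_[2]} (h : toZModEight u = 1) : IsSquare u := by
  obtain ⟨w, hw⟩ : 8 ∣ 1 - u := toZModEight_eq_zero_iff.1 (by simp [h])
  have h2 : ‖(2 : ℤ_[2])‖ = 2⁻¹ := by simpa using PadicInt.norm_p (p := 2)
  apply PadicInt.isSquare_of_norm_lt (a := 1)
  rw [one_pow, hw, mul_one, show (8 : ℤ_[2]) = 2 ^ 3 by norm_num, norm_mul, norm_pow, h2]
  nlinarith [PadicInt.norm_le_one w, norm_nonneg w]

theorem hilbertSym_eq_one_of_toZModEight {a b : ℤ_[2]} (x y : ℤ_[2])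
    (h : toZModEight a * toZModEight x ^ 2 + toZModEight b * toZModEight y ^ 2 = 1) :
    hilbertSym ℚ_[2] a b = 1 := by
  have h' : toZModEight (a * x ^ 2 + b * y ^ 2) = 1 := by simpa using h
  exact hilbertSym_eq_one_of_isSquare_add (isUnit_iff_toZModEight.2 (by rw [h', mul_one]))
    (isSquare_of_toZModEight_eq_one h')

/-- The Hilbert symbol `(u, v)` of `2`-adic units as a function of their residues mod `8`. -/
def hilbertTwo (u v : ZMod 8) : ℤ := if 2 * u = 2 ∨ 2 * v = 2 then 1 else -1

/-- The Hilbert symbol `(u, 2v)` for `2`-adic units `u`, `v` as a function of their residues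
mod `8`. -/
def hilbertTwo' (u v : ZMod 8) : ℤ := if u = 1 ∨ u + 2 * v = 1 then 1 else -1

theorem hilbertSym_two_units (u v : ℤ_[2]ˣ) : hilbertSym ℚ_[2] (u : ℤ_[2]) (v : ℤ_[2]) =
    hilbertTwo (toZModEight u) (toZModEight v) := by
  have hu := isUnit_iff_toZModEight.1 u.isUnit
  have hv := isUnit_iff_toZModEight.1 v.isUnit
  have hone : ∀ a b : ℤ_[2], 4 * toZModEight b = 4 → 2 * toZModEight a = 2 →
      hilbertSym ℚ_[2] a b = 1 := by
    intro a b hb ha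
    have h15 : ∀ c : ZMod 8, 2 * c = 2 → c = 1 ∨ c = 5 := by decide
    rcases h15 _ ha with h | h
    · exact hilbertSym_eq_one_of_toZModEight 1 0 (by simp [h])
    · refine hilbertSym_eq_one_of_toZModEight 1 2 ?_
      rw [h, map_ofNat, map_one, mul_comm (toZModEight b),
        show (2 : ZMod 8) ^ 2 = 4 by decide, hb]
      decide
  unfold hilbertTwo
  split_ifs with h
  · rcases h with h | h
    · exact hone _ _ hv h
    · rw [hilbertSym_comm]
      exact hone _ _ hu h
  · push Not at h
    rw [hilbertSym_eq_neg_one_iff]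
    intro h1
    obtain ⟨x, y, z, hprim, hxyz⟩ := exists_primitive_of_hilbertSym_eq_one h1
    have hmod := congrArg toZModEight hxyz
    simp only [map_add, map_mul, map_pow] at hmod
    simp only [isUnit_iff_toZModEight] at hprim
    have h6 : ∀ c : ZMod 8, 4 * c = 4 → 2 * c ≠ 2 → 2 * c = -2 := by decide
    have key : ∀ x y z : ZMod 8, (4 * x = 4 ∨ 4 * y = 4 ∨ 4 * z = 4) →
        2 * z ^ 2 ≠ -2 * x ^ 2 + -2 * y ^ 2 := by decide +kernel
    refine key _ _ _ hprim ?_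
    rw [hmod]
    linear_combination toZModEight x ^ 2 * h6 _ hu h.1 + toZModEight y ^ 2 * h6 _ hv h.2

theorem hilbertSym_two_unit_two_mul_unit (u v : ℤ_[2]ˣ) :
    hilbertSym ℚ_[2] (u : ℤ_[2]) ((2 : ℕ) * (v : ℤ_[2])) =
      hilbertTwo' (toZModEight u) (toZModEight v) := by
  have hu := isUnit_iff_toZModEight.1 u.isUnit
  have hv := isUnit_iff_toZModEight.1 v.isUnit
  have hcast : (((2 : ℕ) : ℚ_[2]) * (v : ℤ_[2])) = ((2 * v : ℤ_[2]) : ℚ_[2]) := by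
    rw [PadicInt.coe_mul]
    rfl
  rw [hcast]
  unfold hilbertTwo'
  split_ifs with h
  · rcases h with h | h
    · exact hilbertSym_eq_one_of_toZModEight 1 0 (by simp [h])
    · exact hilbertSym_eq_one_of_toZModEight 1 1 (by simpa [map_ofNat toZModEight 2] using h)
  · rw [hilbertSym_eq_neg_one_iff]
    intro h1
    obtain ⟨x, y, z, hprim, hxyz⟩ := exists_primitive_of_hilbertSym_eq_one h1
    have hmod := congrArg toZModEight hxyz
    simp only [map_add, map_mul, map_pow, map_ofNat] at hmod
    simp only [isUnit_iff_toZModEight] at hprim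
    have key : ∀ u v : ZMod 8, 4 * u = 4 → 4 * v = 4 → ¬ (u = 1 ∨ u + 2 * v = 1) →
        ∀ x y z : ZMod 8, (4 * x = 4 ∨ 4 * y = 4 ∨ 4 * z = 4) →
          z ^ 2 ≠ u * x ^ 2 + 2 * v * y ^ 2 := by decide +kernel
    exact key _ _ hu hv h _ _ _ hprim hmod

theorem hilbertSym_two_mul_right {a b c : ℚ_[2]} (ha : a ≠ 0) (hb : b ≠ 0) (hc : c ≠ 0) :
    hilbertSym ℚ_[2] a (b * c) = hilbertSym ℚ_[2] a b * hilbertSym ℚ_[2] a c := by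
  have h₀ : ∀ u v w : ℤ_[2]ˣ, hilbertSym ℚ_[2] (u : ℤ_[2]) ((v : ℤ_[2]) * (w : ℤ_[2])) =
      hilbertTwo (toZModEight u) (toZModEight v * toZModEight w) := fun u v w => by
    simpa using hilbertSym_two_units u (v * w)
  have h₁ : ∀ u v w : ℤ_[2]ˣ,
      hilbertSym ℚ_[2] (u : ℤ_[2]) ((2 : ℕ) * ((v : ℤ_[2]) * (w : ℤ_[2]))) =
        hilbertTwo' (toZModEight u) (toZModEight v * toZModEight w) := fun u v w => by
    simpa using hilbertSym_two_unit_two_mul_unit u (v * w)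
  have h₁' : ∀ u v w : ℤ_[2]ˣ,
      hilbertSym ℚ_[2] ((2 : ℕ) * (u : ℤ_[2])) ((v : ℤ_[2]) * (w : ℤ_[2])) =
        hilbertTwo' (toZModEight v * toZModEight w) (toZModEight u) := fun u v w => by
    rw [hilbertSym_comm]
    simpa using hilbertSym_two_unit_two_mul_unit (v * w) u
  refine hilbertSym_mul_right_of_units ?_ ?_ ?_ ?_ ha hb hc <;> intro u v w <;>
    have hu := isUnit_iff_toZModEight.1 u.isUnit <;>
    have hv := isUnit_iff_toZModEight.1 v.isUnit <;>
    have hw := isUnit_iff_toZModEight.1 w.isUnit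
  · rw [h₀, hilbertSym_two_units, hilbertSym_two_units]
    generalize toZModEight u = u', toZModEight v = v', toZModEight w = w' at *
    clear u v w h₀ h₁ h₁'
    revert u' v' w'
    decide +kernel
  · rw [h₁, hilbertSym_two_unit_two_mul_unit, hilbertSym_two_units]
    generalize toZModEight u = u', toZModEight v = v', toZModEight w = w' at *
    clear u v w h₀ h₁ h₁'
    revert u' v' w'
    decide +kernel
  · rw [h₀, hilbertSym_two_unit_two_mul_unit, hilbertSym_two_unit_two_mul_unit]
    generalize toZModEight u = u', toZModEight v = v', toZModEight w = w' at *
    clear u v w h₀ h₁ h₁'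
    revert u' v' w'
    decide +kernel
  · rw [h₁', hilbertSym_comm, hilbertSym_two_unit_two_mul_unit, hilbertSym_comm,
      hilbertSym_two_unit_two_mul_unit]
    generalize toZModEight u = u', toZModEight v = v', toZModEight w = w' at *
    clear u v w h₀ h₁ h₁'
    revert u' v' w'
    decide +kernel

end TwoAdic

theorem hilbertSym_padic_mul_right {a b c : ℚ_[p]} (ha : a ≠ 0) (hb : b ≠ 0) (hc : c ≠ 0) :
    hilbertSym ℚ_[p] a (b * c) = hilbertSym ℚ_[p] a b * hilbertSym ℚ_[p] a c := by
  rcases eq_or_ne p 2 with rfl | hp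
  · convert hilbertSym_two_mul_right ha hb hc
  · exact hilbertSym_padic_mul_right_of_ne_two hp ha hb hc

end Padic

section Global

/-- The families of local invariants, indexed by the real place and the primes, that are trivial
at almost all places and whose product over all places is `1`. -/
def productFormulaSubmonoid : Submonoid (ℤ × (Nat.Primes → ℤ)) where
  carrier := {f | {q | f.2 q ≠ 1}.Finite ∧ f.1 * ∏ᶠ q, f.2 q = 1}
  one_mem' := by simp
  mul_mem' := by
    rintro f g ⟨hf, hf'⟩ ⟨hg, hg'⟩
    refine ⟨(hf.union hg).subset fun q hq => ?_, ?_⟩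
    · by_contra h
      simp_all
    · have : ∏ᶠ q, (f * g).2 q = (∏ᶠ q, f.2 q) * ∏ᶠ q, g.2 q := finprod_mul_distrib hf hg
      rw [this, Prod.fst_mul, mul_mul_mul_comm, hf', hg', one_mul]

/-- A prime number as a finite place of `ℚ`. -/
def Nat.Prime.place {p : ℕ} (hp : p.Prime) : Nat.Primes := ⟨p, hp⟩

theorem Nat.Prime.place_inj {p q : ℕ} {hp : p.Prime} {hq : q.Prime} :
    hp.place = hq.place ↔ p = q :=
  Subtype.ext_iff

theorem Nat.Primes.eq_place {q : Nat.Primes} {p : ℕ} (hp : p.Prime) :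
    q = hp.place ↔ (q : ℕ) = p :=
  Subtype.ext_iff

theorem mem_productFormulaSubmonoid_of_finset {f : ℤ × (Nat.Primes → ℤ)} (s : Finset Nat.Primes)
    (hs : ∀ q ∉ s, f.2 q = 1) (h : f.1 * ∏ q ∈ s, f.2 q = 1) : f ∈ productFormulaSubmonoid := by
  have hsub : {q | f.2 q ≠ 1} ⊆ (s : Set Nat.Primes) := fun q hq => by
    by_contra hqs
    exact hq (hs q hqs)
  refine ⟨s.finite_toSet.subset hsub, ?_⟩
  rw [finprod_eq_prod_of_mulSupport_subset f.2 hsub, h]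

/-- The Hilbert symbols of two rational numbers at all places. -/
def hilbertFamily (a b : ℚ) : ℤ × (Nat.Primes → ℤ) :=
  (hilbertSym ℝ a b, fun q => hilbertSym ℚ_[(q : ℕ)] a b)

theorem hilbertFamily_snd_place {p : ℕ} [Fact p.Prime] (hp : p.Prime) (a b : ℚ) :
    (hilbertFamily a b).2 hp.place = hilbertSym ℚ_[p] a b :=
  rfl

theorem hilbertFamily_comm (a b : ℚ) : hilbertFamily a b = hilbertFamily b a := by
  simp only [hilbertFamily, hilbertSym_comm (a : ℝ), fun q : Nat.Primes =>
    hilbertSym_comm (a : ℚ_[(q : ℕ)])]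

theorem hilbertFamily_mul_right {a b c : ℚ} (ha : a ≠ 0) (hb : b ≠ 0) (hc : c ≠ 0) :
    hilbertFamily a (b * c) = hilbertFamily a b * hilbertFamily a c := by
  refine Prod.ext ?_ (funext fun q => ?_)
  · simp only [hilbertFamily, Rat.cast_mul, Prod.fst_mul]
    exact hilbertSym_real_mul_right (by exact_mod_cast ha) (by exact_mod_cast hb)
      (by exact_mod_cast hc)
  · simp only [hilbertFamily, Rat.cast_mul, Prod.snd_mul, Pi.mul_apply]
    exact hilbertSym_padic_mul_right (by exact_mod_cast ha) (by exact_mod_cast hb)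
      (by exact_mod_cast hc)

theorem hilbertFamily_sq_right {a : ℚ} (ha : a ≠ 0) (c : ℚ) : hilbertFamily a (c ^ 2) = 1 := by
  refine Prod.ext ?_ (funext fun q => ?_) <;>
  · simp only [hilbertFamily, Rat.cast_pow]
    exact hilbertSym_sq_right (by exact_mod_cast ha) _

theorem hilbertFamily_self {a : ℚ} (ha : a ≠ 0) : hilbertFamily a a = hilbertFamily a (-1) := by
  refine Prod.ext ?_ (funext fun q => ?_) <;>
  · simp only [hilbertFamily, Rat.cast_neg, Rat.cast_one]
    rw [← hilbertSym_neg_mul_right (by exact_mod_cast ha) (-1), neg_mul_neg, mul_one]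

theorem hilbertFamily_eq_one {a b x y z : ℚ} (hz : z ≠ 0) (h : z ^ 2 = a * x ^ 2 + b * y ^ 2) :
    hilbertFamily a b = 1 := by
  refine Prod.ext ?_ (funext fun q => ?_)
  · exact hilbertSym_eq_one_of_sq_eq (x := (x : ℝ)) (y := y) (z := z) (by exact_mod_cast hz)
      (by exact_mod_cast h)
  · exact hilbertSym_eq_one_of_sq_eq (x := (x : ℚ_[(q : ℕ)])) (y := y) (z := z)
      (by exact_mod_cast hz) (by exact_mod_cast h)

/-- A property of nonzero rationals that is closed under products and contains the squares holds
everywhere once it holds at `-1` and at the primes. -/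
theorem Rat.induction_on_generators {P : ℚ → Prop} (neg_one : P (-1))
    (prime : ∀ p : ℕ, p.Prime → P p) (sq : ∀ c : ℚ, c ≠ 0 → P (c ^ 2))
    (mul : ∀ a b : ℚ, a ≠ 0 → b ≠ 0 → P a → P b → P (a * b)) {a : ℚ} (ha : a ≠ 0) : P a := by
  have hnat : ∀ n : ℕ, n ≠ 0 → P n := by
    intro n
    induction n using Nat.recOnMul with
    | zero => simp
    | one => simpa using sq 1 one_ne_zero
    | prime p hp => exact fun _ => prime p hp
    | mul m n hm hn =>
      intro h
      rw [Nat.cast_mul]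
      have hm' := left_ne_zero_of_mul h
      have hn' := right_ne_zero_of_mul h
      exact mul _ _ (by exact_mod_cast hm') (by exact_mod_cast hn') (hm hm') (hn hn')
  have hint : ∀ n : ℤ, n ≠ 0 → P n := by
    intro n hn
    obtain ⟨k, rfl | rfl⟩ := n.eq_nat_or_neg
    · simpa using hnat k (by simpa using hn)
    · have hk : k ≠ 0 := by simpa using hn
      simpa using mul (-1) k (by norm_num) (by exact_mod_cast hk) neg_one (hnat k hk)
  have hden : (a.den : ℚ) ≠ 0 := by exact_mod_cast a.den_ne_zero
  have h := mul ((a.num * a.den : ℤ) : ℚ) ((a.den : ℚ)⁻¹ ^ 2)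
    (by push_cast; exact mul_ne_zero (by simpa using ha) hden) (by simp)
    (hint _ (mul_ne_zero (by simpa using ha) (by exact_mod_cast a.den_ne_zero)))
    (sq _ (inv_ne_zero hden))
  convert h using 1
  nth_rewrite 1 [← Rat.num_div_den a]
  push_cast
  field_simp

theorem exists_unit_eq_intCast {p : ℕ} [Fact p.Prime] {m : ℤ} (hm : ¬ (p : ℤ) ∣ m) :
    ∃ u : ℤ_[p]ˣ, (u : ℤ_[p]) = m := by
  have : IsUnit (m : ℤ_[p]) := by
    by_contra h
    rw [PadicInt.not_isUnit_iff, PadicInt.norm_int_lt_one_iff_dvd] at h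
    exact hm h
  exact ⟨this.unit, rfl⟩

theorem hilbertSym_intCast_eq_one {p : ℕ} [Fact p.Prime] (hp : p ≠ 2) {m n : ℤ}
    (hm : ¬ (p : ℤ) ∣ m) (hn : ¬ (p : ℤ) ∣ n) : hilbertSym ℚ_[p] m n = 1 := by
  obtain ⟨u, hu⟩ := exists_unit_eq_intCast hm
  obtain ⟨v, hv⟩ := exists_unit_eq_intCast hn
  simpa [hu, hv] using hilbertSym_units hp u v

theorem hilbertSym_intCast_prime {p : ℕ} [Fact p.Prime] (hp : p ≠ 2) {m : ℤ}
    (hm : ¬ (p : ℤ) ∣ m) : hilbertSym ℚ_[p] m p = legendreSym p m := by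
  obtain ⟨u, hu⟩ := exists_unit_eq_intCast hm
  simpa [hu, legendreSym] using hilbertSym_unit_p_mul_unit hp u 1

theorem hilbertSym_two_intCast {m n : ℤ} (hm : ¬ (2 : ℤ) ∣ m) (hn : ¬ (2 : ℤ) ∣ n) :
    hilbertSym ℚ_[2] m n = hilbertTwo m n := by
  obtain ⟨u, hu⟩ := exists_unit_eq_intCast (p := 2) hm
  obtain ⟨v, hv⟩ := exists_unit_eq_intCast (p := 2) hn
  simpa [hu, hv] using hilbertSym_two_units u v

theorem hilbertSym_two_intCast_two {m : ℤ} (hm : ¬ (2 : ℤ) ∣ m) :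
    hilbertSym ℚ_[2] m 2 = hilbertTwo' m 1 := by
  obtain ⟨u, hu⟩ := exists_unit_eq_intCast (p := 2) hm
  simpa [hu] using hilbertSym_two_unit_two_mul_unit u 1

theorem hilbertFamily_neg_one_neg_one : hilbertFamily (-1) (-1) ∈ productFormulaSubmonoid := by
  refine mem_productFormulaSubmonoid_of_finset {Nat.prime_two.place} ?_ ?_
  · intro q hq
    rw [Finset.mem_singleton, Nat.Primes.eq_place] at hq
    have h1 : ¬ ((q : ℕ) : ℤ) ∣ -1 := by
      rw [Int.dvd_neg]
      exact_mod_cast q.2.one_lt.ne' ∘ Nat.dvd_one.1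
    simpa [hilbertFamily] using hilbertSym_intCast_eq_one hq h1 h1
  · have h2 : hilbertSym ℚ_[2] (-1) (-1) = -1 := by
      have := hilbertSym_two_intCast (m := -1) (n := -1) (by decide) (by decide)
      simp only [Int.cast_neg, Int.cast_one] at this
      rw [this]
      decide
    have hr : hilbertSym ℝ (-1) (-1) = -1 := by
      rw [hilbertSym_real (by norm_num) (by norm_num)]
      norm_num
    rw [Finset.prod_singleton, hilbertFamily_snd_place]
    simp [hilbertFamily, h2, hr]

theorem Nat.Primes.not_dvd {q : Nat.Primes} {p : ℕ} (hp : p.Prime) (h : (q : ℕ) ≠ p) :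
    ¬ ((q : ℕ) : ℤ) ∣ p := by
  rw [Int.natCast_dvd_natCast, Nat.prime_dvd_prime_iff_eq q.2 hp]
  exact h

theorem hilbertFamily_mem_of_two_prime {p : ℕ} [Fact p.Prime] (hp : p ≠ 2) {m : ℤ}
    (hpm : ¬ (p : ℤ) ∣ m) (hm : ∀ q : Nat.Primes, (q : ℕ) ≠ 2 → (q : ℕ) ≠ p → ¬ ((q : ℕ) : ℤ) ∣ m)
    (h : hilbertSym ℚ_[2] m p * legendreSym p m = 1) :
    hilbertFamily m p ∈ productFormulaSubmonoid := by
  have hpp : p.Prime := Fact.out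
  refine mem_productFormulaSubmonoid_of_finset {Nat.prime_two.place, hpp.place} ?_ ?_
  · intro q hq
    simp only [Finset.mem_insert, Finset.mem_singleton, not_or, Nat.Primes.eq_place] at hq
    simpa [hilbertFamily] using
      hilbertSym_intCast_eq_one hq.1 (hm q hq.1 hq.2) (Nat.Primes.not_dvd hpp hq.2)
  · have hm0 : m ≠ 0 := by
      rintro rfl
      simp at hpm
    rw [Finset.prod_pair (Nat.Prime.place_inj.not.2 hp.symm), hilbertFamily_snd_place,
      hilbertFamily_snd_place]
    have hr : hilbertSym ℝ m p = 1 := by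
      rw [hilbertSym_real (by exact_mod_cast hm0) (by exact_mod_cast hpp.ne_zero)]
      simp [hpp.pos]
    simp only [hilbertFamily, Rat.cast_intCast, Rat.cast_natCast, hr, one_mul]
    rw [hilbertSym_intCast_prime hp hpm]
    exact h

theorem Nat.Prime.mod_eight_of_ne_two {p : ℕ} (hp : p.Prime) (hp2 : p ≠ 2) :
    p % 8 = 1 ∨ p % 8 = 3 ∨ p % 8 = 5 ∨ p % 8 = 7 := by
  have := hp.eq_two_or_odd.resolve_left hp2
  omega

theorem hilbertFamily_neg_one_prime {p : ℕ} (hpp : p.Prime) :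
    hilbertFamily (-1) p ∈ productFormulaSubmonoid := by
  rcases eq_or_ne p 2 with rfl | hp
  · rw [hilbertFamily_eq_one (x := 1) (y := 1) (z := 1) one_ne_zero (by norm_num)]
    exact one_mem _
  have : Fact p.Prime := ⟨hpp⟩
  have h1 : ∀ q : ℕ, q.Prime → ¬ (q : ℤ) ∣ -1 := fun q hq => by
    rw [Int.dvd_neg]
    exact_mod_cast hq.one_lt.ne' ∘ Nat.dvd_one.1
  have key := hilbertFamily_mem_of_two_prime hp (m := -1) (h1 p hpp) (fun q _ _ => h1 q q.2) ?_
  · simpa using key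
  have h2 := hilbertSym_two_intCast (m := -1) (n := p) (by decide)
    (Nat.Primes.not_dvd (q := Nat.prime_two.place) hpp hp.symm)
  rw [Int.cast_natCast] at h2
  rw [h2, legendreSym.at_neg_one hp, ZMod.χ₄_nat_mod_four, Int.cast_natCast,
    ← ZMod.natCast_mod p 8, ← Nat.mod_mod_of_dvd p (by norm_num : 4 ∣ 8)]
  rcases hpp.mod_eight_of_ne_two hp with h | h | h | h <;> rw [h] <;> decide

theorem hilbertFamily_two_odd_prime {p : ℕ} (hpp : p.Prime) (hp : p ≠ 2) :
    hilbertFamily 2 p ∈ productFormulaSubmonoid := by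
  have : Fact p.Prime := ⟨hpp⟩
  have key := hilbertFamily_mem_of_two_prime hp (m := 2)
    (Nat.Primes.not_dvd (q := hpp.place) Nat.prime_two hp)
    (fun q hq _ => Nat.Primes.not_dvd Nat.prime_two hq) ?_
  · simpa using key
  have h2 := hilbertSym_two_intCast_two (m := p)
    (Nat.Primes.not_dvd (q := Nat.prime_two.place) hpp hp.symm)
  rw [Int.cast_natCast] at h2
  rw [hilbertSym_comm, Int.cast_ofNat, h2, legendreSym.at_two hp, ZMod.χ₈_nat_mod_eight,
    Int.cast_natCast, ← ZMod.natCast_mod p 8]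
  rcases hpp.mod_eight_of_ne_two hp with h | h | h | h <;> rw [h] <;> decide

theorem hilbertFamily_odd_primes {p q : ℕ} (hpp : p.Prime) (hqp : q.Prime) (hp : p ≠ 2)
    (hq : q ≠ 2) (hpq : p ≠ q) : hilbertFamily p q ∈ productFormulaSubmonoid := by
  have : Fact p.Prime := ⟨hpp⟩
  have : Fact q.Prime := ⟨hqp⟩
  have hpq' := Nat.Primes.not_dvd (q := hpp.place) hqp hpq
  have hqp' := Nat.Primes.not_dvd (q := hqp.place) hpp hpq.symm
  refine mem_productFormulaSubmonoid_of_finset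
    {Nat.prime_two.place, hpp.place, hqp.place} ?_ ?_
  · intro l hl
    simp only [Finset.mem_insert, Finset.mem_singleton, not_or, Nat.Primes.eq_place] at hl
    simpa [hilbertFamily] using hilbertSym_intCast_eq_one hl.1
      (Nat.Primes.not_dvd hpp hl.2.1) (Nat.Primes.not_dvd hqp hl.2.2)
  · rw [Finset.prod_insert (by simp [Nat.Prime.place_inj, hp.symm, hq.symm]),
      Finset.prod_pair (Nat.Prime.place_inj.not.2 hpq), hilbertFamily_snd_place,
      hilbertFamily_snd_place, hilbertFamily_snd_place]
    have hr : hilbertSym ℝ p q = 1 := by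
      rw [hilbertSym_real (by exact_mod_cast hpp.ne_zero) (by exact_mod_cast hqp.ne_zero)]
      simp [hpp.pos]
    have hsym_q : hilbertSym ℚ_[q] p q = legendreSym q p := by
      simpa using hilbertSym_intCast_prime hq hqp'
    have hsym_p : hilbertSym ℚ_[p] p q = legendreSym p q := by
      rw [hilbertSym_comm]
      simpa using hilbertSym_intCast_prime hp hpq'
    have hsym_two : hilbertSym ℚ_[2] p q = hilbertTwo (p : ZMod 8) (q : ZMod 8) := by
      simpa using hilbertSym_two_intCast
        (Nat.Primes.not_dvd (q := Nat.prime_two.place) hpp hp.symm)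
        (Nat.Primes.not_dvd (q := Nat.prime_two.place) hqp hq.symm)
    simp only [hilbertFamily, Rat.cast_natCast, hr, one_mul]
    rw [hsym_two, hsym_p, hsym_q, mul_comm (legendreSym p q),
      legendreSym.quadratic_reciprocity hp hq hpq, pow_mul,
      ← ZMod.χ₄_eq_neg_one_pow (hpp.eq_two_or_odd.resolve_left hp),
      ZMod.χ₄_nat_mod_four, ← Nat.mod_mod_of_dvd p (by norm_num : 4 ∣ 8),
      ← ZMod.natCast_mod p 8, ← ZMod.natCast_mod q 8]
    have hodd : (-1 : ℤ) ^ (q / 2) = ZMod.χ₄ (q % 8 % 4 : ℕ) := by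
      rw [← ZMod.χ₄_eq_neg_one_pow (hqp.eq_two_or_odd.resolve_left hq), ZMod.χ₄_nat_mod_four,
        Nat.mod_mod_of_dvd q (by norm_num : 4 ∣ 8)]
    rcases hpp.mod_eight_of_ne_two hp with h | h | h | h
    · rw [h, show ZMod.χ₄ (1 % 4 : ℕ) = 1 by decide, one_pow]
      simp [hilbertTwo]
    · rw [h, show ZMod.χ₄ (3 % 4 : ℕ) = -1 by decide, hodd]
      rcases hqp.mod_eight_of_ne_two hq with h' | h' | h' | h' <;> rw [h'] <;> decide
    · rw [h, show ZMod.χ₄ (5 % 4 : ℕ) = 1 by decide, one_pow]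
      rcases hqp.mod_eight_of_ne_two hq with h' | h' | h' | h' <;> rw [h'] <;> decide
    · rw [h, show ZMod.χ₄ (7 % 4 : ℕ) = -1 by decide, hodd]
      rcases hqp.mod_eight_of_ne_two hq with h' | h' | h' | h' <;> rw [h'] <;> decide

theorem hilbertFamily_primes {p q : ℕ} (hp : p.Prime) (hq : q.Prime) :
    hilbertFamily p q ∈ productFormulaSubmonoid := by
  rcases eq_or_ne p q with rfl | hpq
  · rw [hilbertFamily_self (by exact_mod_cast hp.ne_zero), hilbertFamily_comm]
    exact hilbertFamily_neg_one_prime hp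
  rcases eq_or_ne p 2 with rfl | hp2
  · exact hilbertFamily_two_odd_prime hq hpq.symm
  rcases eq_or_ne q 2 with rfl | hq2
  · rw [hilbertFamily_comm]
    exact hilbertFamily_two_odd_prime hp hpq
  exact hilbertFamily_odd_primes hp hq hp2 hq2 hpq

/-- Hilbert's product formula for the symbols of two nonzero rational numbers. -/
theorem hilbertFamily_mem_productFormulaSubmonoid {a b : ℚ} (ha : a ≠ 0) (hb : b ≠ 0) :
    hilbertFamily a b ∈ productFormulaSubmonoid := by
  have hright : ∀ a : ℚ, a ≠ 0 → hilbertFamily a (-1) ∈ productFormulaSubmonoid →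
      (∀ p : ℕ, p.Prime → hilbertFamily a p ∈ productFormulaSubmonoid) →
      ∀ b : ℚ, b ≠ 0 → hilbertFamily a b ∈ productFormulaSubmonoid := by
    intro a ha h1 hp b hb
    refine Rat.induction_on_generators (P := fun b => hilbertFamily a b ∈ productFormulaSubmonoid)
      h1 hp (fun c _ => ?_) (fun b c hb hc h h' => ?_) hb
    · rw [hilbertFamily_sq_right ha]
      exact one_mem _
    · rw [hilbertFamily_mul_right ha hb hc]
      exact mul_mem h h'
  refine hright a ha ?_ (fun p hp => ?_) b hb <;> rw [hilbertFamily_comm]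
  · exact hright _ (by norm_num) hilbertFamily_neg_one_neg_one
      (fun p hp => hilbertFamily_neg_one_prime hp) a ha
  · refine hright _ (by exact_mod_cast hp.ne_zero) ?_ (fun q hq => hilbertFamily_primes hp hq) a ha
    rw [hilbertFamily_comm]
    exact hilbertFamily_neg_one_prime hp

end Global

/-- For a non-degenerate quadratic form over `ℚ` diagonalized as
`⟨a i⟩`, the Hasse invariant `ε_ν(q)` equals `+1` for all but finitely many places
`ν`, and the product over all places (including the real one) equals `+1`. -/
theorem hasse_product_formula {n : ℕ} (a : Fin n → ℚ) (ha : ∀ i, a i ≠ 0) :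
    {q : Nat.Primes | epsP a q ≠ 1}.Finite ∧
      epsReal a * ∏ᶠ q : Nat.Primes, epsP a q = 1 := by
  have hmem : (epsReal a, epsP a) ∈ productFormulaSubmonoid := by
    have : (epsReal a, epsP a) =
        ∏ i : Fin n, ∏ j : Fin n, if i < j then hilbertFamily (a i) (a j) else 1 := by
      refine Prod.ext ?_ (funext fun q => ?_)
      · simp only [epsReal, hasseInv, Prod.fst_prod, apply_ite Prod.fst, Prod.fst_one]
        rfl
      · simp only [epsP, hasseInv, Prod.snd_prod, Finset.prod_apply, apply_ite Prod.snd,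
          ite_apply, Prod.snd_one]
        rfl
    rw [this]
    refine prod_mem fun i _ => prod_mem fun j _ => ?_
    split_ifs
    · exact hilbertFamily_mem_productFormulaSubmonoid (ha i) (ha j)
    · exact one_mem _
  exact hmem

end
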